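/- There is a constant C₀ ≥ 1 such that whenever c₁ ≥ C₀·c₂ > 0, for all polymers X ⊆ Y, all κ > 0, and all φ of class C² on a neighborhood of Y, one has G_κ(X,φ) ≤ G_κ(Y,φ); equivalently, c₁(‖∇φ‖²_{L²(X)} + ‖∇²φ‖²_{B²_∞(X)}) + c₂·∫_{∂X}|∇φ|² dH¹ ≤ c₁(‖∇φ‖²_{L²(Y)} + ‖∇²φ‖²_{B²_∞(Y)}) + c₂·∫_{∂Y}|∇φ|² dH¹. -/

import Mathlib

open MeasureTheory

noncomputable section

/-- The plane, with its Euclidean structure. -/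
abbrev E2 := EuclideanSpace ℝ (Fin 2)

/-- The closed unit square (block) of the standard tessellation of `ℝ²` with lower-left
corner `p ∈ ℤ²`. -/
def unitSquare (p : ℤ × ℤ) : Set E2 :=
  {x | (p.1 : ℝ) ≤ x 0 ∧ x 0 ≤ (p.1 : ℝ) + 1 ∧ (p.2 : ℝ) ≤ x 1 ∧ x 1 ≤ (p.2 : ℝ) + 1}

/-- The polymer (finite union of closed unit squares) indexed by a finite set `S ⊆ ℤ²`. -/
def polymerOf (S : Finset (ℤ × ℤ)) : Set E2 := ⋃ p ∈ S, unitSquare p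

/-- `‖∇ⁿf(x)‖`, the norm of the `n`-th derivative of `f` at `x`. -/
def dNorm (n : ℕ) (f : E2 → ℝ) (x : E2) : ℝ := ‖iteratedFDeriv ℝ n f x‖

/-- The exponent `κ · log G_κ(X, φ)` of the large-field regulator, with block structure
recorded by the indexing finset `S`. -/
def regExponent (c₁ c₂ : ℝ) (S : Finset (ℤ × ℤ)) (φ : E2 → ℝ) : ℝ :=
  c₁ * ((∫ x in polymerOf S, dNorm 1 φ x ^ 2) +
        ∑ p ∈ S, ⨆ x ∈ unitSquare p, dNorm 2 φ x ^ 2) +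
  c₂ * (∫ x in frontier (polymerOf S), dNorm 1 φ x ^ 2 ∂(μH[1]))


/-- The open unit square. -/
def openSq (p : ℤ × ℤ) : Set E2 :=
  {x | (p.1 : ℝ) < x 0 ∧ x 0 < (p.1 : ℝ) + 1 ∧ (p.2 : ℝ) < x 1 ∧ x 1 < (p.2 : ℝ) + 1}

/-- The boundary of the unit square. -/
def bdSq (p : ℤ × ℤ) : Set E2 := unitSquare p \ openSq p

theorem openSq_subset (p : ℤ × ℤ) : openSq p ⊆ unitSquare p :=
  fun _ hx => ⟨hx.1.le, hx.2.1.le, hx.2.2.1.le, hx.2.2.2.le⟩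

theorem isOpen_openSq (p : ℤ × ℤ) : IsOpen (openSq p) := by
  have h0 : Continuous fun x : E2 => x 0 := by fun_prop
  have h1 : Continuous fun x : E2 => x 1 := by fun_prop
  exact (isOpen_lt continuous_const h0).inter ((isOpen_lt h0 continuous_const).inter
    ((isOpen_lt continuous_const h1).inter (isOpen_lt h1 continuous_const)))

theorem isClosed_unitSquare (p : ℤ × ℤ) : IsClosed (unitSquare p) := by
  have h0 : Continuous fun x : E2 => x 0 := by fun_prop
  have h1 : Continuous fun x : E2 => x 1 := by fun_prop
  exact (isClosed_le continuous_const h0).inter ((isClosed_le h0 continuous_const).inter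
    ((isClosed_le continuous_const h1).inter (isClosed_le h1 continuous_const)))

theorem convex_unitSquare (p : ℤ × ℤ) : Convex ℝ (unitSquare p) := by
  intro x hx y hy a b ha hb hab
  obtain ⟨h1, h2, h3, h4⟩ := hx
  obtain ⟨k1, k2, k3, k4⟩ := hy
  have hb' : b = 1 - a := by linarith
  subst hb'
  refine ⟨?_, ?_, ?_, ?_⟩ <;>
    simp only [PiLp.add_apply, PiLp.smul_apply, smul_eq_mul] <;> nlinarith

theorem norm_sub_le_two {p : ℤ × ℤ} {x y : E2} (hx : x ∈ unitSquare p) (hy : y ∈ unitSquare p) :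
    ‖x - y‖ ≤ 2 := by
  obtain ⟨h1, h2, h3, h4⟩ := hx
  obtain ⟨k1, k2, k3, k4⟩ := hy
  rw [EuclideanSpace.norm_eq, Real.sqrt_le_left (by norm_num)]
  simp only [Fin.sum_univ_two, PiLp.sub_apply, Real.norm_eq_abs, sq_abs]
  nlinarith

theorem isCompact_unitSquare (p : ℤ × ℤ) : IsCompact (unitSquare p) := by
  refine Metric.isCompact_of_isClosed_isBounded (isClosed_unitSquare p) ?_
  refine Metric.isBounded_iff.2 ⟨2, fun x hx y hy => ?_⟩
  rw [dist_eq_norm]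
  exact norm_sub_le_two hx hy

theorem isCompact_polymerOf (S : Finset (ℤ × ℤ)) : IsCompact (polymerOf S) :=
  S.isCompact_biUnion fun p _ => isCompact_unitSquare p

theorem isCompact_bdSq (p : ℤ × ℤ) : IsCompact (bdSq p) :=
  (isCompact_unitSquare p).diff (isOpen_openSq p)

theorem openSq_unitSquare_eq {p q : ℤ × ℤ} {x : E2} (hq : x ∈ openSq q) (hp : x ∈ unitSquare p) :
    p = q := by
  obtain ⟨h1, h2, h3, h4⟩ := hp
  obtain ⟨k1, k2, k3, k4⟩ := hq
  have a1 : p.1 < q.1 + 1 := by exact_mod_cast h1.trans_lt k2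
  have a2 : q.1 < p.1 + 1 := by exact_mod_cast k1.trans_le h2
  have a3 : p.2 < q.2 + 1 := by exact_mod_cast h3.trans_lt k4
  have a4 : q.2 < p.2 + 1 := by exact_mod_cast k3.trans_le h4
  ext <;> omega

theorem volume_openSq (p : ℤ × ℤ) : volume (openSq p) = 1 := by
  have h := (EuclideanSpace.volume_preserving_symm_measurableEquiv_toLp (Fin 2)).measure_preimage
    (s := Set.pi Set.univ fun i : Fin 2 =>
      Set.Ioo ((![(p.1 : ℝ), p.2] : Fin 2 → ℝ) i) ((![(p.1 : ℝ) + 1, p.2 + 1] : Fin 2 → ℝ) i))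
    (MeasurableSet.univ_pi fun i => measurableSet_Ioo).nullMeasurableSet
  rw [Real.volume_pi_Ioo] at h
  simp only [Fin.prod_univ_two] at h
  simp at h
  rw [← h]
  congr 1
  ext x
  simp [openSq, Fin.forall_fin_two, and_assoc]

theorem seg_measure (u v : E2) (hv : ‖v‖ ≤ 1) :
    μH[1] ((fun t : ℝ => u + t • v) '' Set.Icc 0 1) ≤ 1 := by
  have hl : LipschitzWith 1 (fun t : ℝ => u + t • v) := by
    refine LipschitzWith.of_dist_le_mul fun s t => ?_
    rw [dist_add_left, dist_eq_norm, ← sub_smul, norm_smul, dist_eq_norm]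
    simpa using mul_le_mul_of_nonneg_left hv (norm_nonneg (s - t))
  refine (hl.hausdorffMeasure_image_le zero_le_one _).trans ?_
  rw [hausdorffMeasure_real]
  simp

theorem bdSq_measure (p : ℤ × ℤ) : μH[1] (bdSq p) ≤ 4 := by
  let F : ℝ → ℝ → E2 → Set E2 := fun a b v => (fun t : ℝ => !₂[a, b] + t • v) '' Set.Icc 0 1
  have hsub : bdSq p ⊆ (F p.1 p.2 !₂[0, 1] ∪ F (p.1 + 1) p.2 !₂[0, 1]) ∪
      (F p.1 p.2 !₂[1, 0] ∪ F p.1 (p.2 + 1) !₂[1, 0]) := by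
    rintro x ⟨⟨h1, h2, h3, h4⟩, hx⟩
    simp only [openSq, Set.mem_ofPred_eq, not_and_or, not_lt] at hx
    rcases hx with hx | hx | hx | hx
    · refine Or.inl (Or.inl ⟨x 1 - p.2, ⟨by linarith, by linarith⟩, ?_⟩)
      ext i; fin_cases i <;> simp <;> linarith
    · refine Or.inl (Or.inr ⟨x 1 - p.2, ⟨by linarith, by linarith⟩, ?_⟩)
      ext i; fin_cases i <;> simp <;> linarith
    · refine Or.inr (Or.inl ⟨x 0 - p.1, ⟨by linarith, by linarith⟩, ?_⟩)
      ext i; fin_cases i <;> simp <;> linarith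
    · refine Or.inr (Or.inr ⟨x 0 - p.1, ⟨by linarith, by linarith⟩, ?_⟩)
      ext i; fin_cases i <;> simp <;> linarith
  have n1 : ‖(!₂[0, 1] : E2)‖ ≤ 1 := by simp [EuclideanSpace.norm_eq]
  have n2 : ‖(!₂[1, 0] : E2)‖ ≤ 1 := by simp [EuclideanSpace.norm_eq]
  calc μH[1] (bdSq p) ≤ _ := measure_mono hsub
    _ ≤ (1 + 1) + (1 + 1) := by
      refine (measure_union_le _ _).trans (add_le_add ?_ ?_)
      · exact (measure_union_le _ _).trans
          (add_le_add (seg_measure _ _ n1) (seg_measure _ _ n1))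
      · exact (measure_union_le _ _).trans
          (add_le_add (seg_measure _ _ n2) (seg_measure _ _ n2))
    _ = 4 := by norm_num

theorem frontier_polymer_subset (S : Finset (ℤ × ℤ)) :
    frontier (polymerOf S) ⊆ ⋃ p ∈ S, bdSq p := by
  intro x hx
  rw [(isCompact_polymerOf S).isClosed.frontier_eq] at hx
  obtain ⟨h1, h2⟩ := hx
  simp only [polymerOf, Set.mem_iUnion] at h1
  obtain ⟨p, hp, hxp⟩ := h1
  simp only [Set.mem_iUnion]
  refine ⟨p, hp, hxp, fun ho => h2 ?_⟩
  refine interior_maximal ?_ (isOpen_openSq p) ho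
  exact (openSq_subset p).trans (Set.subset_biUnion_of_mem (u := unitSquare) hp)

theorem frontier_polymer_subset' {S T : Finset (ℤ × ℤ)} (hST : S ⊆ T) :
    frontier (polymerOf S) ⊆ frontier (polymerOf T) ∪ ⋃ p ∈ T \ S, bdSq p := by
  intro x hx
  rw [(isCompact_polymerOf S).isClosed.frontier_eq] at hx
  obtain ⟨h1, h2⟩ := hx
  have hYX : polymerOf T = polymerOf S ∪ polymerOf (T \ S) := by
    unfold polymerOf
    rw [← Finset.set_biUnion_union, Finset.union_sdiff_of_subset hST]
  by_cases hY : x ∈ frontier (polymerOf T)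
  · exact Or.inl hY
  right
  have hint : x ∈ interior (polymerOf T) := by
    by_contra hc
    apply hY
    rw [(isCompact_polymerOf T).isClosed.frontier_eq]
    exact ⟨hYX ▸ Or.inl h1, hc⟩
  have hZ : x ∈ polymerOf (T \ S) := by
    by_contra hc
    apply h2
    refine interior_maximal (s := polymerOf S)
      (t := interior (polymerOf T) ∩ (polymerOf (T \ S))ᶜ) ?_ ?_ ⟨hint, hc⟩
    · rintro y ⟨hy1, hy2⟩
      have := interior_subset hy1
      rw [hYX] at this
      exact this.resolve_right hy2
    · exact isOpen_interior.inter (isCompact_polymerOf _).isClosed.isOpen_compl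
  simp only [polymerOf, Set.mem_iUnion] at hZ h1 ⊢
  obtain ⟨p, hp, hxp⟩ := h1
  obtain ⟨q, hq, hxq⟩ := hZ
  refine ⟨q, hq, hxq, fun ho => ?_⟩
  have := openSq_unitSquare_eq ho hxp
  subst this
  exact (Finset.mem_sdiff.1 hq).2 hp

theorem setIntegral_union_finset_le {μ : Measure E2} {f : E2 → ℝ} (hf : ∀ x, 0 ≤ f x)
    (A : Set E2) (hA : IntegrableOn f A μ) (D : ℤ × ℤ → Set E2) (R : Finset (ℤ × ℤ))
    (hD : ∀ q ∈ R, IntegrableOn f (D q) μ) :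
    ∫ x in A ∪ ⋃ q ∈ R, D q, f x ∂μ ≤ ∫ x in A, f x ∂μ + ∑ q ∈ R, ∫ x in D q, f x ∂μ := by
  induction R using Finset.induction_on with
  | empty => simp
  | insert a R ha ih =>
    have ih' := ih fun q hq => hD q (Finset.mem_insert_of_mem hq)
    have h1 : IntegrableOn f (A ∪ ⋃ q ∈ R, D q) μ :=
      hA.union ((integrableOn_finset_iUnion).2 fun q hq => hD q (Finset.mem_insert_of_mem hq))
    have h2 := hD a (Finset.mem_insert_self _ _)
    rw [Finset.sum_insert ha]
    have he : A ∪ ⋃ q ∈ insert a R, D q = (A ∪ ⋃ q ∈ R, D q) ∪ D a := by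
      rw [Finset.set_biUnion_insert, Set.union_assoc, Set.union_comm (D a)]
    rw [he]
    have h3 : ∫ x in (A ∪ ⋃ q ∈ R, D q) ∪ D a, f x ∂μ ≤
        ∫ x, f x ∂(μ.restrict (A ∪ ⋃ q ∈ R, D q) + μ.restrict (D a)) :=
      integral_mono_measure (Measure.restrict_union_le _ _) (Filter.Eventually.of_forall hf)
        (Integrable.add_measure h1 h2)
    rw [integral_add_measure h1 h2] at h3
    linarith

section Main

variable {φ : E2 → ℝ} {U : Set E2}

theorem continuousOn_dNorm (hU : IsOpen U) (hφ : ContDiffOn ℝ 2 φ U) {n : ℕ} (hn : n ≤ 2) :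
    ContinuousOn (fun x => dNorm n φ x ^ 2) U := by
  have h := hφ.continuousOn_iteratedFDerivWithin (m := n) (by exact_mod_cast hn) hU.uniqueDiffOn
  have h' := h.congr fun x hx => (iteratedFDerivWithin_of_isOpen n hU hx).symm
  exact h'.norm.pow 2

theorem le_iSup_sq (hU : IsOpen U) (hφ : ContDiffOn ℝ 2 φ U) {q : ℤ × ℤ} (hq : unitSquare q ⊆ U)
    {x : E2} (hx : x ∈ unitSquare q) :
    dNorm 2 φ x ^ 2 ≤ ⨆ x ∈ unitSquare q, dNorm 2 φ x ^ 2 := by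
  obtain ⟨K, hK⟩ := (isCompact_unitSquare q).bddAbove_image
    ((continuousOn_dNorm hU hφ le_rfl).mono hq)
  have hb : BddAbove (Set.range fun x => ⨆ _ : x ∈ unitSquare q, dNorm 2 φ x ^ 2) := by
    refine ⟨max K 0, ?_⟩
    rintro _ ⟨y, rfl⟩
    by_cases hy : y ∈ unitSquare q
    · simp only [hy, ciSup_unique]
      exact le_max_of_le_left (hK ⟨y, hy, rfl⟩)
    · simp [hy]
  have := le_ciSup hb x
  simpa [hx] using this

theorem pointwise (hU : IsOpen U) (hφ : ContDiffOn ℝ 2 φ U) {q : ℤ × ℤ} (hq : unitSquare q ⊆ U)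
    {x y : E2} (hx : x ∈ unitSquare q) (hy : y ∈ unitSquare q) :
    dNorm 1 φ x ^ 2 ≤ 2 * dNorm 1 φ y ^ 2 + 8 * ⨆ x ∈ unitSquare q, dNorm 2 φ x ^ 2 := by
  set M := ⨆ x ∈ unitSquare q, dNorm 2 φ x ^ 2 with hM
  have hM0 : 0 ≤ M := (sq_nonneg _).trans (le_iSup_sq hU hφ hq hx)
  have hL : ‖iteratedFDeriv ℝ 1 φ x - iteratedFDeriv ℝ 1 φ y‖ ≤ √M * ‖x - y‖ := by
    refine (convex_unitSquare q).norm_image_sub_le_of_norm_fderiv_le (𝕜 := ℝ) ?_ ?_ hy hx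
    · intro z hz
      have hc : ContDiffAt ℝ 2 φ z := hφ.contDiffAt (hU.mem_nhds (hq hz))
      exact hc.differentiableAt_iteratedFDeriv (by norm_num)
    · intro z hz
      rw [norm_fderiv_iteratedFDeriv]
      exact Real.le_sqrt_of_sq_le (le_iSup_sq hU hφ hq hz)
  have hxy := norm_sub_le_two hx hy
  have h1 : dNorm 1 φ x ≤ dNorm 1 φ y + 2 * √M := by
    have := norm_sub_norm_le (iteratedFDeriv ℝ 1 φ x) (iteratedFDeriv ℝ 1 φ y)
    have h2 := mul_le_mul_of_nonneg_left hxy (Real.sqrt_nonneg M)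
    unfold dNorm
    linarith
  have h0 : 0 ≤ dNorm 1 φ x := norm_nonneg _
  have h3 := pow_le_pow_left₀ h0 h1 2
  have h4 := Real.sq_sqrt hM0
  nlinarith [sq_nonneg (dNorm 1 φ y - 2 * √M)]

theorem bd_integrable (hU : IsOpen U) (hφ : ContDiffOn ℝ 2 φ U) {q : ℤ × ℤ}
    (hq : unitSquare q ⊆ U) : IntegrableOn (fun x => dNorm 1 φ x ^ 2) (bdSq q) μH[1] :=
  ((continuousOn_dNorm hU hφ one_le_two).mono
    (Set.sdiff_subset.trans hq)).integrableOn_of_subset_isCompact (isCompact_bdSq q)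
      (isCompact_bdSq q).measurableSet subset_rfl
      ((bdSq_measure q).trans_lt (by norm_num)).ne

theorem vol_integrable (hU : IsOpen U) (hφ : ContDiffOn ℝ 2 φ U) {K : Set E2} (hK : IsCompact K)
    (hq : K ⊆ U) : IntegrableOn (fun x => dNorm 1 φ x ^ 2) K :=
  ((continuousOn_dNorm hU hφ one_le_two).mono hq).integrableOn_compact hK

theorem trace_bound (hU : IsOpen U) (hφ : ContDiffOn ℝ 2 φ U) {q : ℤ × ℤ}
    (hq : unitSquare q ⊆ U) :
    ∫ x in bdSq q, dNorm 1 φ x ^ 2 ∂μH[1] ≤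
      32 * ((∫ x in openSq q, dNorm 1 φ x ^ 2) + ⨆ x ∈ unitSquare q, dNorm 2 φ x ^ 2) := by
  set M := ⨆ x ∈ unitSquare q, dNorm 2 φ x ^ 2 with hM
  set I := ∫ x in openSq q, dNorm 1 φ x ^ 2 with hI
  have hI0 : 0 ≤ I := integral_nonneg fun x => sq_nonneg _
  have hint : IntegrableOn (fun x => dNorm 1 φ x ^ 2) (openSq q) :=
    (vol_integrable hU hφ (isCompact_unitSquare q) hq).mono_set (openSq_subset q)
  have hv : volume.real (openSq q) = 1 := by simp [Measure.real, volume_openSq]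
  have hvt : volume (openSq q) ≠ ⊤ := by simp [volume_openSq]
  have hcon : ∀ c : ℝ, Integrable (fun _ : E2 => c) (volume.restrict (openSq q)) :=
    fun c => integrableOn_const hvt
  have hpt : ∀ x ∈ unitSquare q, dNorm 1 φ x ^ 2 ≤ 2 * I + 8 * M := by
    intro x hx
    have h := setIntegral_mono_on (μ := volume) (s := openSq q)
      (f := fun _ => dNorm 1 φ x ^ 2) (g := fun y => 2 * dNorm 1 φ y ^ 2 + 8 * M)
      (hcon _) (Integrable.fun_add (hint.const_mul 2) (hcon (8 * M)))
      (isOpen_openSq q).measurableSet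
      (fun y hy => pointwise hU hφ hq hx (openSq_subset q hy))
    rw [setIntegral_const, integral_add (hint.const_mul 2) (hcon _),
      integral_const_mul, setIntegral_const, hv] at h
    simpa using h
  have hM0 : 0 ≤ M := by
    refine Real.iSup_nonneg fun x => Real.iSup_nonneg fun _ => sq_nonneg _
  have hbt : μH[1] (bdSq q) ≠ ⊤ := ((bdSq_measure q).trans_lt (by norm_num)).ne
  have hb : (μH[1] : Measure E2).real (bdSq q) ≤ 4 := by
    have := ENNReal.toReal_mono (by norm_num) (bdSq_measure q)
    simpa [Measure.real] using this
  have h := setIntegral_mono_on (μ := μH[1]) (s := bdSq q)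
    (g := fun _ => 2 * I + 8 * M) (bd_integrable hU hφ hq)
    (integrableOn_const hbt) (isCompact_bdSq q).measurableSet (fun y hy => hpt y hy.1)
  rw [setIntegral_const, smul_eq_mul] at h
  have h5 := mul_le_mul_of_nonneg_right hb (show 0 ≤ 2 * I + 8 * M by positivity)
  linarith

theorem bulk_bound (hU : IsOpen U) (hφ : ContDiffOn ℝ 2 φ U) {S T : Finset (ℤ × ℤ)}
    (hST : S ⊆ T) (hT : polymerOf T ⊆ U) :
    (∫ x in polymerOf S, dNorm 1 φ x ^ 2) + ∑ q ∈ T \ S, ∫ x in openSq q, dNorm 1 φ x ^ 2 ≤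
      ∫ x in polymerOf T, dNorm 1 φ x ^ 2 := by
  have hY := vol_integrable hU hφ (isCompact_polymerOf T) hT
  have hsub : ∀ q ∈ T, unitSquare q ⊆ polymerOf T := fun q hq =>
    Set.subset_biUnion_of_mem (u := unitSquare) hq
  have hX : polymerOf S ⊆ polymerOf T := Set.iUnion₂_subset fun q hq => hsub q (hST hq)
  have hO : ∀ q ∈ T \ S, openSq q ⊆ polymerOf T := fun q hq =>
    (openSq_subset q).trans (hsub q (Finset.mem_sdiff.1 hq).1)
  have hW : ⋃ q ∈ T \ S, openSq q ⊆ polymerOf T := Set.iUnion₂_subset hO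
  rw [← integral_biUnion_finset _ (fun q _ => (isOpen_openSq q).measurableSet) ?_
    (fun q hq => hY.mono_set (hO q hq)), ← setIntegral_union ?_ ?_ (hY.mono_set hX)
    (hY.mono_set hW)]
  · exact setIntegral_mono_set hY (Filter.Eventually.of_forall fun x => sq_nonneg _)
      (Set.union_subset hX hW).eventuallyLE
  · rw [Set.disjoint_left]
    intro x hx hx'
    simp only [polymerOf, Set.mem_iUnion] at hx hx'
    obtain ⟨p, hp, hxp⟩ := hx
    obtain ⟨q, hq, hxq⟩ := hx'
    have := openSq_unitSquare_eq hxq hxp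
    subst this
    exact (Finset.mem_sdiff.1 hq).2 hp
  · exact (isOpen_biUnion fun q _ => isOpen_openSq q).measurableSet
  · intro p _ q _ hpq
    rw [Function.onFun, Set.disjoint_left]
    exact fun x hx hx' => hpq (openSq_unitSquare_eq hx' (openSq_subset p hx))

theorem boundary_bound (hU : IsOpen U) (hφ : ContDiffOn ℝ 2 φ U) {S T : Finset (ℤ × ℤ)}
    (hST : S ⊆ T) (hT : polymerOf T ⊆ U) :
    ∫ x in frontier (polymerOf S), dNorm 1 φ x ^ 2 ∂μH[1] ≤
      ∫ x in frontier (polymerOf T), dNorm 1 φ x ^ 2 ∂μH[1] +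
        ∑ q ∈ T \ S, ∫ x in bdSq q, dNorm 1 φ x ^ 2 ∂μH[1] := by
  have hsub : ∀ q ∈ T, unitSquare q ⊆ U := fun q hq =>
    (Set.subset_biUnion_of_mem (u := unitSquare) hq).trans hT
  have hbd : ∀ q ∈ T, IntegrableOn (fun x => dNorm 1 φ x ^ 2) (bdSq q) μH[1] :=
    fun q hq => bd_integrable hU hφ (hsub q hq)
  have hA : IntegrableOn (fun x => dNorm 1 φ x ^ 2) (frontier (polymerOf T)) μH[1] :=
    (integrableOn_finset_iUnion.2 hbd).mono_set (frontier_polymer_subset T)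
  have hD : ∀ q ∈ T \ S, IntegrableOn (fun x => dNorm 1 φ x ^ 2) (bdSq q) μH[1] :=
    fun q hq => hbd q (Finset.mem_sdiff.1 hq).1
  refine le_trans ?_ (setIntegral_union_finset_le (fun x => sq_nonneg _) _ hA bdSq _ hD)
  exact setIntegral_mono_set (hA.union (integrableOn_finset_iUnion.2 hD))
    (Filter.Eventually.of_forall fun x => sq_nonneg _)
    (frontier_polymer_subset' hST).eventuallyLE

end Main

/-- There is `C₀ ≥ 1` such that whenever `c₁ ≥ C₀ c₂ > 0`, for all polymers `X ⊆ Y`,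
all `κ > 0` and all `φ` of class `C²` on a neighborhood of `Y`,
`G_κ(X, φ) ≤ G_κ(Y, φ)`; equivalently (and as formalized),
`c₁(‖∇φ‖²_{L²(X)} + ‖∇²φ‖²_{B²_∞(X)}) + c₂ ∫_{∂X} |∇φ|² dH¹ ≤ (same with Y)`. -/
theorem stmt9 :
    ∃ C₀ : ℝ, 1 ≤ C₀ ∧
      ∀ c₁ c₂ : ℝ, 0 < c₂ → C₀ * c₂ ≤ c₁ →
        ∀ S T : Finset (ℤ × ℤ), S.Nonempty → S ⊆ T →
          ∀ κ : ℝ, 0 < κ →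
            ∀ (φ : E2 → ℝ) (U : Set E2), IsOpen U → polymerOf T ⊆ U →
              ContDiffOn ℝ 2 φ U →
              Real.exp (κ⁻¹ * regExponent c₁ c₂ S φ) ≤
                Real.exp (κ⁻¹ * regExponent c₁ c₂ T φ) := by
  refine ⟨32, by norm_num, ?_⟩
  intro c₁ c₂ hc₂ hc S T _ hST κ hκ φ U hU hT hφ
  refine Real.exp_le_exp.2 (mul_le_mul_of_nonneg_left ?_ (inv_pos.2 hκ).le)
  have hsub : ∀ q ∈ T, unitSquare q ⊆ U := fun q hq =>
    (Set.subset_biUnion_of_mem (u := unitSquare) hq).trans hT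
  have h1 := boundary_bound hU hφ hST hT
  have h2 := bulk_bound hU hφ hST hT
  have h3 := Finset.sum_le_sum fun q (hq : q ∈ T \ S) =>
    trace_bound hU hφ (hsub q (Finset.mem_sdiff.1 hq).1)
  rw [← Finset.mul_sum, Finset.sum_add_distrib] at h3
  have h4 := Finset.sum_sdiff (f := fun q => ⨆ x ∈ unitSquare q, dNorm 2 φ x ^ 2) hST
  have h5 : 0 ≤ ∑ q ∈ T \ S, ⨆ x ∈ unitSquare q, dNorm 2 φ x ^ 2 :=
    Finset.sum_nonneg fun q _ => Real.iSup_nonneg fun x => Real.iSup_nonneg fun _ => sq_nonneg _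
  have h6 : 0 ≤ ∑ q ∈ T \ S, ∫ x in openSq q, dNorm 1 φ x ^ 2 :=
    Finset.sum_nonneg fun q _ => integral_nonneg fun x => sq_nonneg _
  unfold regExponent
  rw [← h4]
  set a := ∑ q ∈ T \ S, ⨆ x ∈ unitSquare q, dNorm 2 φ x ^ 2
  set b := ∑ q ∈ T \ S, ∫ x in openSq q, dNorm 1 φ x ^ 2
  have hc₁ : 0 ≤ c₁ := by linarith
  have k1 := mul_le_mul_of_nonneg_left (h1.trans (add_le_add_right h3 _)) hc₂.le
  have k2 := mul_le_mul_of_nonneg_left h2 hc₁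
  have k3 := mul_le_mul_of_nonneg_right hc (add_nonneg h6 h5)
  nlinarith

end
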